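/- For all integers n ≥ 1, k ≥ 1, and 0 ≤ d ≤ n, (n + 1) · |LD_n(k, d)| = binom(n + d, d) · binom(k(n+1) + n − d − 1, n − d). -/

import Mathlib

/-- The relation on letters (`none` = `U`, `some i` = `D_i`) requiring that two
consecutive down-steps have weakly decreasing labels. -/
def DownWeak : Option ℕ → Option ℕ → Prop :=
  fun x y => ∀ a b, x = some a → y = some b → b ≤ a

/-- `w` is a `k`-labeled Dyck word of length `2n`. -/
def IsLDWord (n k : ℕ) (w : List (Option ℕ)) : Prop :=
  w.length = 2 * n ∧ w.count none = n ∧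
  (∀ x ∈ w, ∀ i, x = some i → i ≤ k) ∧
  (∀ p : List (Option ℕ), p <+: w → p.length ≤ 2 * p.count none) ∧
  w.Chain' DownWeak

/-- The ballot condition allowing `c` initial units of height: every prefix has at most `c` more
down-steps than up-steps. -/
def IsBallot (c : ℕ) (w : List (Option ℕ)) : Prop :=
  ∀ p : List (Option ℕ), p <+: w → p.length ≤ 2 * p.count none + c

/-- The weakly decreasing run of down-steps with a given multiset of labels. -/
def downRun {k : ℕ} (m : Multiset (Fin (k + 1))) : List (Option ℕ) :=
  (m.sort (· ≥ ·)).map fun i : Fin (k + 1) => some i.val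

/-- The concatenation of the runs of down-steps, each preceded by an up-step. -/
def upRuns {k : ℕ} : List (Multiset (Fin (k + 1))) → List (Option ℕ)
  | [] => []
  | m :: l => none :: (downRun m ++ upRuns l)

section Runs

variable {k : ℕ}

lemma isChain_downRun (m : Multiset (Fin (k + 1))) : (downRun m).IsChain DownWeak := by
  rw [downRun, List.isChain_map]
  refine (List.Pairwise.isChain (Multiset.pairwise_sort m (· ≥ ·))).imp ?_
  rintro a b h x y hx hy
  simp only [Option.some.injEq] at hx hy
  subst hx hy
  exact h

lemma isChain_downRun_append_upRuns (m : Multiset (Fin (k + 1)))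
    (l : List (Multiset (Fin (k + 1)))) : (downRun m ++ upRuns l).IsChain DownWeak := by
  induction l generalizing m with
  | nil => simpa [upRuns] using isChain_downRun m
  | cons m' l ih =>
    rw [upRuns, List.isChain_append, List.isChain_cons]
    refine ⟨isChain_downRun m, ⟨?_, ih m'⟩, ?_⟩
    · intro y _ a b h
      simp at h
    · intro x _ y hy a b _ h
      simp at hy
      simp [← hy] at h

@[simp] lemma length_downRun (m : Multiset (Fin (k + 1))) :
    (downRun m).length = m.card := by
  simp [downRun]

@[simp] lemma count_none_downRun (m : Multiset (Fin (k + 1))) :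
    (downRun m).count none = 0 := by
  simp [downRun, List.count_eq_zero]

@[simp] lemma count_zero_downRun (m : Multiset (Fin (k + 1))) :
    (downRun m).count (some 0) = m.count 0 := by
  have h : Function.Injective (fun i : Fin (k + 1) => some (i : ℕ)) := fun a b h => by
    simpa [Fin.ext_iff] using h
  have := List.count_map_of_injective (m.sort (· ≥ ·)) _ h 0
  simp only [Fin.val_zero] at this
  rw [downRun, this, ← Multiset.coe_count, Multiset.sort_eq]

lemma length_upRuns (l : List (Multiset (Fin (k + 1)))) :
    (upRuns l).length = (l.map Multiset.card).sum + l.length := by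
  induction l with
  | nil => simp [upRuns]
  | cons m l ih => simp [upRuns, ih]; ring

lemma count_none_upRuns (l : List (Multiset (Fin (k + 1)))) :
    (upRuns l).count none = l.length := by
  induction l with
  | nil => simp [upRuns]
  | cons m l ih => simp [upRuns, ih]

lemma count_zero_upRuns (l : List (Multiset (Fin (k + 1)))) :
    (upRuns l).count (some 0) = (l.map (Multiset.count 0)).sum := by
  induction l with
  | nil => simp [upRuns]
  | cons m l ih => simp [upRuns, ih]

lemma le_of_some_mem_downRun {m : Multiset (Fin (k + 1))} {i : ℕ} (h : some i ∈ downRun m) :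
    i ≤ k := by
  simp only [downRun, List.mem_map, Option.some.injEq] at h
  obtain ⟨a, -, rfl⟩ := h
  exact a.is_le

lemma le_of_some_mem_upRuns {l : List (Multiset (Fin (k + 1)))} {i : ℕ}
    (h : some i ∈ upRuns l) : i ≤ k := by
  induction l with
  | nil => simp [upRuns] at h
  | cons m l ih =>
    simp only [upRuns, List.mem_cons, List.mem_append, reduceCtorEq, false_or] at h
    exact h.elim le_of_some_mem_downRun ih

lemma downRun_injective : Function.Injective (downRun (k := k)) := fun m m' h => by
  have : m.sort (· ≥ ·) = m'.sort (· ≥ ·) :=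
    List.map_injective_iff.2 (fun a b h => by simpa [Fin.ext_iff] using h) h
  rw [← Multiset.sort_eq m (· ≥ ·), this, Multiset.sort_eq]

lemma takeWhile_downRun_append_upRuns (m : Multiset (Fin (k + 1)))
    (l : List (Multiset (Fin (k + 1)))) :
    (downRun m ++ upRuns l).takeWhile Option.isSome = downRun m := by
  rw [List.takeWhile_append_of_pos]
  · cases l <;> simp [upRuns]
  · simp [downRun]

lemma downRun_append_upRuns_inj {m m' : Multiset (Fin (k + 1))}
    {l l' : List (Multiset (Fin (k + 1)))}
    (h : downRun m ++ upRuns l = downRun m' ++ upRuns l') : m = m' ∧ l = l' := by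
  have hm : ∀ {m m' : Multiset (Fin (k + 1))} {l l' : List (Multiset (Fin (k + 1)))},
      downRun m ++ upRuns l = downRun m' ++ upRuns l' → m = m' := fun h => by
    have := congrArg (List.takeWhile Option.isSome) h
    rw [takeWhile_downRun_append_upRuns, takeWhile_downRun_append_upRuns] at this
    exact downRun_injective this
  induction l generalizing m m' l' with
  | nil =>
    obtain rfl := hm h
    cases l' <;> simp_all [upRuns]
  | cons a l ih =>
    obtain rfl := hm h
    cases l' with
    | nil => simp [upRuns] at h
    | cons b l' =>
      simp only [upRuns, List.append_cancel_left_eq, List.cons.injEq, true_and] at h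
      simp [ih h]

lemma exists_eq_downRun_append_upRuns (w : List (Option ℕ)) (hw : w.IsChain DownWeak)
    (hk : ∀ x ∈ w, ∀ i, x = some i → i ≤ k) :
    ∃ (m : Multiset (Fin (k + 1))) (l : List (Multiset (Fin (k + 1)))),
      w = downRun m ++ upRuns l := by
  induction w with
  | nil => exact ⟨0, [], by simp [downRun, upRuns]⟩
  | cons x w ih =>
    rw [List.isChain_cons] at hw
    obtain ⟨m, l, rfl⟩ := ih hw.2 fun x hx => hk x (List.mem_cons_of_mem _ hx)
    cases x with
    | none => exact ⟨0, m :: l, by simp [downRun, upRuns]⟩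
    | some a =>
      have ha : a < k + 1 := Nat.lt_succ_of_le (hk _ List.mem_cons_self a rfl)
      refine ⟨⟨a, ha⟩ ::ₘ m, l, ?_⟩
      have hle : ∀ b ∈ m, (⟨a, ha⟩ : Fin (k + 1)) ≥ b := by
        intro b hb
        have hp := Multiset.pairwise_sort m (· ≥ ·)
        rw [← Multiset.mem_sort (· ≥ ·)] at hb
        have hhead := hw.1
        unfold downRun at hhead
        cases hs : m.sort (· ≥ ·) with
        | nil => simp [hs] at hb
        | cons c t =>
          rw [hs] at hhead hb hp
          have hca : (c : ℕ) ≤ a := hhead (some c) (by simp) a c rfl rfl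
          rcases List.mem_cons.1 hb with rfl | hb
          · exact hca
          · exact le_trans (List.rel_of_pairwise_cons hp hb) hca
      have hcons : downRun (⟨a, ha⟩ ::ₘ m) = some a :: downRun m := by
        rw [downRun, Multiset.sort_cons _ _ _ hle]
        rfl
      rw [hcons, List.cons_append]

lemma isBallot_nil (c : ℕ) : IsBallot c [] := by
  intro p hp
  simp [List.prefix_nil.1 hp]

lemma isBallot_none_cons (c : ℕ) (w : List (Option ℕ)) :
    IsBallot c (none :: w) ↔ IsBallot (c + 1) w := by
  constructor
  · intro h p hp
    have := h (none :: p) (by simpa using hp)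
    simp at this
    omega
  · intro h p hp
    rcases List.prefix_cons_iff.1 hp with rfl | ⟨t, rfl, ht⟩
    · simp
    · have := h t ht
      simp
      omega

lemma isBallot_some_cons (c a : ℕ) (w : List (Option ℕ)) :
    IsBallot c (some a :: w) ↔ 1 ≤ c ∧ IsBallot (c - 1) w := by
  constructor
  · intro h
    have h1 : 1 ≤ c := by simpa using h [some a] (by simp)
    refine ⟨h1, fun p hp => ?_⟩
    have := h (some a :: p) (by simpa using hp)
    simp at this
    omega
  · rintro ⟨h1, h⟩ p hp
    rcases List.prefix_cons_iff.1 hp with rfl | ⟨t, rfl, ht⟩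
    · simp
    · have := h t ht
      simp
      omega

lemma isBallot_map_some_append (c : ℕ) (t : List ℕ) (w : List (Option ℕ)) :
    IsBallot c (t.map some ++ w) ↔ t.length ≤ c ∧ IsBallot (c - t.length) w := by
  induction t generalizing c with
  | nil => simp
  | cons a t ih =>
    rw [List.map_cons, List.cons_append, isBallot_some_cons, ih, List.length_cons, ← and_assoc,
      Nat.sub_sub, Nat.add_comm 1]
    exact and_congr_left fun _ => by omega

lemma isBallot_downRun_append (c : ℕ) (m : Multiset (Fin (k + 1))) (w : List (Option ℕ)) :
    IsBallot c (downRun m ++ w) ↔ m.card ≤ c ∧ IsBallot (c - m.card) w := by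
  have : downRun m = ((m.sort (· ≥ ·)).map Fin.val).map some := by simp [downRun]
  rw [this, isBallot_map_some_append]
  simp

lemma isBallot_downRun_append_upRuns (c : ℕ) (m : Multiset (Fin (k + 1)))
    (l : List (Multiset (Fin (k + 1)))) :
    IsBallot c (downRun m ++ upRuns l) ↔
      ∀ i ≤ l.length, (((m :: l).map Multiset.card).take (i + 1)).sum ≤ i + c := by
  induction l generalizing c m with
  | nil =>
    rw [isBallot_downRun_append]
    simp [upRuns, isBallot_nil]
  | cons m' l ih =>
    rw [isBallot_downRun_append, upRuns, isBallot_none_cons, ih]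
    constructor
    · rintro ⟨h0, h⟩ i hi
      cases i with
      | zero => simpa using h0
      | succ i =>
        have := h i (by simpa using hi)
        simp only [List.map_cons, List.take_succ_cons, List.sum_cons] at this ⊢
        omega
    · intro h
      have h0 := h 0 (by simp)
      simp only [List.map_cons, List.take_succ_cons, List.sum_cons, List.take_zero,
        List.sum_nil] at h0
      refine ⟨by omega, fun i hi => ?_⟩
      have := h (i + 1) (by simpa using hi)
      simp only [List.map_cons, List.take_succ_cons, List.sum_cons] at this ⊢
      omega

end Runs

section CycleLemma

variable {n : ℕ}

/-- The sequence `s` satisfies `s 0 + ⋯ + s i ≤ i` for all `i ≤ n`. -/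
def IsSubdiagonal (s : Fin (n + 1) → ℕ) : Prop :=
  ∀ i ≤ n, ∑ j ∈ Finset.range (i + 1), s (Fin.ofNat (n + 1) j) ≤ i

lemma sum_range_ofNat_eq_sum_take (s : Fin (n + 1) → ℕ) {i : ℕ} (hi : i ≤ n + 1) :
    ∑ j ∈ Finset.range i, s (Fin.ofNat (n + 1) j) = ((List.ofFn s).take i).sum := by
  induction i with
  | zero => simp
  | succ i ih =>
    rw [Finset.sum_range_succ, ih (by omega), List.sum_take_succ _ _ (by simpa using hi),
      List.getElem_ofFn]
    simp [Fin.ofNat, Nat.mod_eq_of_lt (show i < n + 1 by omega)]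

lemma sum_range_ofNat (s : Fin (n + 1) → ℕ) :
    ∑ j ∈ Finset.range (n + 1), s (Fin.ofNat (n + 1) j) = ∑ i, s i := by
  rw [sum_range_ofNat_eq_sum_take s le_rfl, List.take_of_length_le (by simp), List.sum_ofFn]

/-- The cycle lemma: a sequence of `n + 1` natural numbers with sum `n` has exactly one
subdiagonal rotation. -/
lemma existsUnique_isSubdiagonal_rotate (s : Fin (n + 1) → ℕ) (hs : ∑ i, s i = n) :
    ∃! r : Fin (n + 1), IsSubdiagonal fun i => s (i + r) := by
  let P : ℕ → ℤ := fun m => ∑ j ∈ Finset.range m, (s (Fin.ofNat (n + 1) j) : ℤ) - m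
  have hper : ∀ m, P (m + (n + 1)) = P m - 1 := by
    intro m
    induction m with
    | zero =>
      have := sum_range_ofNat s
      rw [hs] at this
      simp only [P, zero_add]
      rw [← Nat.cast_sum, this]
      simp
    | succ m ih =>
      have h1 : Fin.ofNat (n + 1) (m + (n + 1)) = Fin.ofNat (n + 1) m := by
        simp [Fin.ofNat]
      simp only [P] at ih ⊢
      rw [show m + 1 + (n + 1) = m + (n + 1) + 1 by ring, Finset.sum_range_succ, h1,
        Finset.sum_range_succ]
      push_cast at ih ⊢
      linarith
  have hgood : ∀ r : Fin (n + 1), IsSubdiagonal (fun i => s (i + r)) ↔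
      ∀ i ≤ n, P (r + (i + 1)) < P r := by
    intro r
    refine forall₂_congr fun i _ => ?_
    have h : ∑ j ∈ Finset.range (i + 1), s (Fin.ofNat (n + 1) j + r)
        = ∑ j ∈ Finset.range (i + 1), s (Fin.ofNat (n + 1) (r + j)) := by
      refine Finset.sum_congr rfl fun j _ => ?_
      congr 1
      simp [Fin.ext_iff, Fin.ofNat, Fin.val_add, add_comm]
    simp only [P]
    rw [← Nat.cast_sum, ← Nat.cast_sum, Finset.sum_range_add _ (r : ℕ) (i + 1), ← h]
    omega
  obtain ⟨r, hr, hmax⟩ : ∃ r ≤ n, ∀ j ≤ n, P j ≤ P r ∧ (r < j → P j < P r) := by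
    obtain ⟨r, hr, hmax⟩ := Finset.exists_max_image (Finset.range (n + 1))
      (fun j => toLex (P j, j)) ⟨0, by simp⟩
    refine ⟨r, by simpa [Nat.lt_succ_iff] using hr, fun j hj => ?_⟩
    have := hmax j (by simpa [Nat.lt_succ_iff] using hj)
    rw [Prod.Lex.toLex_le_toLex] at this
    simp only at this
    omega
  refine ⟨⟨r, by omega⟩, (hgood _).2 fun i hi => ?_, fun r' hr' => ?_⟩
  · by_cases hri : r + (i + 1) ≤ n
    · exact (hmax _ hri).2 (by omega)
    · have h1 := hper (r + i - n)
      rw [show r + i - n + (n + 1) = r + (i + 1) by omega] at h1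
      have h2 := (hmax (r + i - n) (by omega)).1
      simp only
      omega
  · have h' := (hgood r').1 hr'
    have hr'n := r'.is_le
    refine Fin.ext ?_
    rcases lt_trichotomy (r' : ℕ) r with h | h | h
    · have h1 := h' (r - r' - 1) (by omega)
      rw [show (r' : ℕ) + (r - r' - 1 + 1) = r by omega] at h1
      have h2 := (hmax r' hr'n).1
      omega
    · exact h
    · have h1 := h' (n - r' + r) (by omega)
      rw [show (r' : ℕ) + (n - r' + r + 1) = r + (n + 1) by omega, hper] at h1
      have h2 := (hmax r' hr'n).2 h
      omega

/-- Rotations partition the sequences with total weight `n` into classes of `n + 1` sequences with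
exactly one subdiagonal member each. -/
lemma card_isSubdiagonal {α : Type*} (wt : α → ℕ) (A : (Fin (n + 1) → α) → Prop)
    (hsum : ∀ f, A f → ∑ i, wt (f i) = n)
    (hrot : ∀ f r, A f → A fun i => f (i + r)) :
    (n + 1) * Nat.card {f // IsSubdiagonal (fun i => wt (f i)) ∧ A f} = Nat.card {f // A f} := by
  let Φ : Fin (n + 1) × {f // IsSubdiagonal (fun i => wt (f i)) ∧ A f} → {f // A f} :=
    fun x => ⟨fun i => x.2.1 (i + x.1), hrot _ _ x.2.2.2⟩
  have hΦ : Function.Bijective Φ := by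
    constructor
    · rintro ⟨r, f, hf, hAf⟩ ⟨r', f', hf', hAf'⟩ h
      have h0 : ∀ i, f (i + r) = f' (i + r') := fun i => congrFun (Subtype.ext_iff.1 h) i
      have hr : r = r' := by
        have hu := existsUnique_isSubdiagonal_rotate (fun i => wt (f (i + r)))
          (hsum _ (hrot f r hAf))
        refine neg_injective (hu.unique (y₁ := -r) (y₂ := -r') ?_ ?_)
        · simpa using hf
        · simpa [h0] using hf'
      subst hr
      have : f = f' := funext fun i => by simpa using h0 (i - r)
      subst this
      rfl
    · rintro ⟨f, hf⟩
      obtain ⟨r, hr, -⟩ := existsUnique_isSubdiagonal_rotate (fun i => wt (f i)) (hsum f hf)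
      exact ⟨⟨-r, fun i => f (i + r), hr, hrot f r hf⟩, Subtype.ext (by simp [Φ])⟩
  rw [← Nat.card_congr (Equiv.ofBijective Φ hΦ), Nat.card_prod, Nat.card_fin]

end CycleLemma

lemma card_sum_eq {ι : Type*} [Fintype ι] (d : ℕ) :
    Nat.card {f : ι → ℕ // ∑ i, f i = d} = (Fintype.card ι + d - 1).choose d := by
  classical
  rw [← Nat.card_congr (Sym.equivNatSumOfFintype ι d), Nat.card_eq_fintype_card,
    Sym.card_sym_eq_choose]

/-- A family of multisets over `Fin (k + 1)` amounts to the multiplicities of `0` together with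
the multiplicities of the other elements. -/
noncomputable def multiplicitiesEquiv (ι : Type*) (k : ℕ) :
    (ι → Multiset (Fin (k + 1))) ≃ (ι → ℕ) × (ι × Fin k → ℕ) :=
  calc (ι → Multiset (Fin (k + 1)))
    _ ≃ (ι → ℕ × (Fin k → ℕ)) := Equiv.piCongrRight fun _ =>
        (Multiset.toFinsupp.toEquiv.trans Finsupp.equivFunOnFinite).trans
          (Fin.consEquiv fun _ => ℕ).symm
    _ ≃ (ι → ℕ) × (ι → Fin k → ℕ) := Equiv.arrowProdEquivProdArrow _ _ _
    _ ≃ (ι → ℕ) × (ι × Fin k → ℕ) := Equiv.prodCongr (Equiv.refl _) (Equiv.curry _ _ _).symm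

lemma card_families (n k d : ℕ) (hd : d ≤ n) :
    Nat.card {f : Fin (n + 1) → Multiset (Fin (k + 1)) //
        ∑ i, (f i).card = n ∧ ∑ i, (f i).count 0 = d} =
      (n + d).choose d * (k * (n + 1) + n - d - 1).choose (n - d) := by
  have e := (multiplicitiesEquiv (Fin (n + 1)) k).subtypeEquiv
    (p := fun f => ∑ i, (f i).card = n ∧ ∑ i, (f i).count 0 = d)
    (q := fun x => ∑ i, x.1 i = d ∧ ∑ i, x.2 i = n - d) (fun f => by
      have h1 : ∀ i, (f i).card = (f i).count 0 + ∑ j : Fin k, (f i).count j.succ := fun i => by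
        rw [← Fin.sum_univ_succ (fun j => (f i).count j), Multiset.sum_count_eq_card (by simp)]
      have h2 : ∀ i, ((multiplicitiesEquiv _ k) f).1 i = (f i).count 0 := fun i => rfl
      have h3 : ∀ i j, ((multiplicitiesEquiv _ k) f).2 (i, j) = (f i).count j.succ :=
        fun i j => rfl
      simp only [h1, h2, h3, Finset.sum_add_distrib, Fintype.sum_prod_type]
      omega)
  rw [Nat.card_congr (e.trans (Equiv.subtypeProdEquivProd (p := fun a : Fin (n + 1) → ℕ => ∑ i, a i = d)
    (q := fun b : Fin (n + 1) × Fin k → ℕ => ∑ i, b i = n - d))), Nat.card_prod, card_sum_eq, card_sum_eq]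
  simp only [Fintype.card_fin, Fintype.card_prod]
  rw [show n + 1 + d - 1 = n + d by omega, mul_comm (n + 1) k,
    Nat.add_sub_assoc hd]

/-- The word whose runs of down-steps are prescribed by `f`, separated by single up-steps. -/
def wordOfRuns {n k : ℕ} (f : Fin (n + 1) → Multiset (Fin (k + 1))) : List (Option ℕ) :=
  downRun (f 0) ++ upRuns (List.ofFn fun i : Fin n => f i.succ)

lemma isLDWord_wordOfRuns {n k d : ℕ} (f : Fin (n + 1) → Multiset (Fin (k + 1))) :
    (IsLDWord n k (wordOfRuns f) ∧ (wordOfRuns f).count (some 0) = d) ↔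
      IsSubdiagonal (fun i => (f i).card) ∧ ∑ i, (f i).card = n ∧ ∑ i, (f i).count 0 = d := by
  have hlen : (wordOfRuns f).length = ∑ i, (f i).card + n := by
    simp [wordOfRuns, length_upRuns, List.map_ofFn, List.sum_ofFn, Fin.sum_univ_succ, add_assoc]
  have hnone : (wordOfRuns f).count none = n := by
    simp [wordOfRuns, count_none_upRuns]
  have hzero : (wordOfRuns f).count (some 0) = ∑ i, (f i).count 0 := by
    simp [wordOfRuns, count_zero_upRuns, List.map_ofFn, List.sum_ofFn, Fin.sum_univ_succ]
  have hlabel : ∀ x ∈ wordOfRuns f, ∀ i, x = some i → i ≤ k := by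
    rintro x hx i rfl
    exact (List.mem_append.1 hx).elim le_of_some_mem_downRun le_of_some_mem_upRuns
  have hchain : (wordOfRuns f).IsChain DownWeak := isChain_downRun_append_upRuns _ _
  have hballot : (∀ p : List (Option ℕ), p <+: wordOfRuns f → p.length ≤ 2 * p.count none) ↔
      IsSubdiagonal (fun i => (f i).card) := by
    refine (isBallot_downRun_append_upRuns 0 _ _).trans ?_
    rw [List.length_ofFn]
    refine forall₂_congr fun i hi => ?_
    rw [sum_range_ofNat_eq_sum_take (fun i => (f i).card) (by omega), ← List.ofFn_cons, List.map_ofFn, add_zero]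
    have : (Fin.cons (f 0) fun i => f i.succ : Fin (n + 1) → Multiset (Fin (k + 1))) = f :=
      Fin.cons_self_tail f
    rw [this]
    rfl
  rw [IsLDWord, hlen, hnone, hzero, hballot]
  constructor
  · rintro ⟨⟨h1, -, -, h2, -⟩, h3⟩
    exact ⟨h2, by omega, h3⟩
  · rintro ⟨h2, h1, h3⟩
    exact ⟨⟨by omega, rfl, hlabel, h2, hchain⟩, h3⟩

lemma wordOfRuns_injective {n k : ℕ} : Function.Injective (wordOfRuns (n := n) (k := k)) := by
  intro f g h
  obtain ⟨h0, h1⟩ := downRun_append_upRuns_inj h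
  have h2 := List.ofFn_injective h1
  exact funext (Fin.cases h0 fun i => congrFun h2 i)

lemma exists_wordOfRuns_eq {n k : ℕ} {w : List (Option ℕ)} (hw : IsLDWord n k w) :
    ∃ f : Fin (n + 1) → Multiset (Fin (k + 1)), wordOfRuns f = w := by
  obtain ⟨-, hn, hk, -, hc⟩ := hw
  obtain ⟨m, l, rfl⟩ := exists_eq_downRun_append_upRuns w hc hk
  have hl : l.length = n := by simpa [count_none_upRuns] using hn
  subst hl
  exact ⟨Fin.cons m l.get, by simp [wordOfRuns]⟩

theorem stmt7 (n k d : ℕ) (hn : 1 ≤ n) (hk : 1 ≤ k) (hd : d ≤ n) :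
    (n + 1) * Nat.card { w : List (Option ℕ) // IsLDWord n k w ∧ w.count (some 0) = d }
      = Nat.choose (n + d) d * Nat.choose (k * (n + 1) + n - d - 1) (n - d) := by
  let A : (Fin (n + 1) → Multiset (Fin (k + 1))) → Prop :=
    fun f => ∑ i, (f i).card = n ∧ ∑ i, (f i).count 0 = d
  let Φ : {f : Fin (n + 1) → Multiset (Fin (k + 1)) // IsSubdiagonal (fun i => (f i).card) ∧ A f} →
      {w : List (Option ℕ) // IsLDWord n k w ∧ w.count (some 0) = d} :=
    fun f => ⟨wordOfRuns f.1, (isLDWord_wordOfRuns f.1).2 f.2⟩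
  have hΦ : Function.Bijective Φ := by
    constructor
    · intro f g h
      exact Subtype.ext (wordOfRuns_injective (Subtype.ext_iff.1 h))
    · rintro ⟨w, hw⟩
      obtain ⟨f, rfl⟩ := exists_wordOfRuns_eq hw.1
      exact ⟨⟨f, (isLDWord_wordOfRuns f).1 hw⟩, rfl⟩
  rw [← Nat.card_congr (Equiv.ofBijective Φ hΦ), card_isSubdiagonal Multiset.card A (fun _ h => h.1),
    card_families n k d hd]
  rintro f r ⟨h1, h2⟩
  exact ⟨(Equiv.sum_comp (Equiv.addRight r) fun i => (f i).card).trans h1,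
    (Equiv.sum_comp (Equiv.addRight r) fun i => (f i).count 0).trans h2⟩
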